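/- Let F ∈ K[c,x] be the generic homogeneous polynomial of degree d ≥ n and let Φ_d ∈ K[c,x] be the universal flex polynomial, bihomogeneous of bidegree (Σ_{k=1}^n n!/k, d·Σ_{k=1}^n n!/k − (n+1)!), determined modulo F by R_{F,ℓ} ≡ ℓ^{n!}·Φ_d (mod F) for every linear form ℓ. Then the ideal (F, Φ_d) ⊂ K[c,x] has height 2, and x₀ is not a zero divisor modulo (F, Φ_d). -/

import Mathlib

/-!
STATEMENT 17: Let `F ∈ K[c,x]` be the generic homogeneous polynomial of degree
`d ≥ n` and `Φ_d ∈ K[c,x]` the universal flex polynomial: bihomogeneous of bidegree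
`(Σ_{k=1}^n n!/k, d·Σ_{k=1}^n n!/k − (n+1)!)` in `(c,x)` and satisfying
`R_{F,ℓ} ≡ ℓ^{n!}·Φ_d (mod F)` for every linear form `ℓ`.  Then the ideal
`(F, Φ_d) ⊂ K[c,x]` has height 2, and `x₀` is not a zero divisor modulo `(F, Φ_d)`.

Setup: `K[c] = A := MvPolynomial (Fin (n+1) →₀ ℕ) K`, `K[c,x] = AX :=
MvPolynomial (Fin (n+1)) A`, `F = Σ_{|a|=d} c_a x^a ∈ AX`; the resultant for degrees
`(1,…,n,1)` is abstract (natural over commutative `K`-algebras, with the vanishing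
property over `K`).  Bihomogeneity of `Φ_d`: homogeneity in `x` (as an element of
`A[x]`) together with homogeneity in `c` of every `x`-coefficient.  The height of an
ideal is the infimum of `Order.height` over the primes containing it; "`x₀` is not a
zero divisor mod `(F,Φ_d)`" reads `x₀·g ∈ (F,Φ_d) → g ∈ (F,Φ_d)`.
-/

open MvPolynomial Polynomial

set_option synthInstance.maxHeartbeats 1000000
set_option maxHeartbeats 1000000

/-- The `k`-th directional Taylor coefficient `f_k(x,y)` of `f`, as a polynomial in
the variables `y` with coefficients in `R[x]`; `f(x + t y) = Σ_k f_k(x,y) t^k / k!`. -/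
noncomputable def dirCoeffY {R : Type} [CommRing R] {n : ℕ}
    (f : MvPolynomial (Fin (n + 1)) R) (k : ℕ) :
    MvPolynomial (Fin (n + 1)) (MvPolynomial (Fin (n + 1)) R) :=
  (k.factorial : MvPolynomial (Fin (n + 1)) (MvPolynomial (Fin (n + 1)) R)) *
    (Polynomial.coeff
      (MvPolynomial.aeval
        (fun i => Polynomial.C (MvPolynomial.C (MvPolynomial.X i)) +
          Polynomial.X * Polynomial.C (MvPolynomial.X i)) f) k)

/-- The generic homogeneous polynomial `F = Σ_{|a|=d} c_a x^a` of degree `d`. -/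
noncomputable def genericPoly (K : Type) [CommRing K] (n d : ℕ) :
    MvPolynomial (Fin (n + 1)) (MvPolynomial (Fin (n + 1) →₀ ℕ) K) :=
  ∑ a ∈ Finset.finsuppAntidiag (Finset.univ : Finset (Fin (n + 1))) d,
    MvPolynomial.monomial a (MvPolynomial.X a)

/-- Krull's bound for two polynomials without constant term, in any number of variables. -/
theorem MvPolynomial.exists_isPrime_height_le_two {K ι : Type} [Field K]
    (f g : MvPolynomial ι K) (hf : constantCoeff f = 0) (hg : constantCoeff g = 0) :
    ∃ P : Ideal (MvPolynomial ι K), P.IsPrime ∧ f ∈ P ∧ g ∈ P ∧ P.height ≤ 2 := by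
  classical
  obtain ⟨s, f, g, rfl, rfl⟩ := exists_finset_rename₂ f g
  rw [constantCoeff_rename] at hf hg
  let D := MvPolynomial {x // x ∉ s} K
  let L := FractionRing D
  let B := MvPolynomial s D
  let E := MvPolynomial s L
  let e : MvPolynomial ι K ≃ₐ[K] B :=
    (renameEquiv K (Equiv.sumCompl (· ∈ s)).symm).trans (sumAlgEquiv K _ _)
  let _ : Algebra B E := algebraMvPolynomial
  have hloc : IsLocalization ((nonZeroDivisors D).map (MvPolynomial.C (σ := s))) E :=
    MvPolynomial.isLocalization _ _
  have he (q : MvPolynomial s K) :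
      algebraMap B E (e (rename (↑) q)) = map (algebraMap K L) q := by
    have h1 : rename (Equiv.sumCompl (· ∈ s)).symm (rename (fun x : s => (x : ι)) q) =
        rename Sum.inl q := by
      rw [rename_rename]
      congr 2
      ext x
      simp
    have h2 := DFunLike.congr_fun
      (sumAlgEquiv_comp_rename_inl (R := K) (S₁ := s) (S₂ := {x // x ∉ s})) q
    have h3 : e (rename (↑) q) = map (algebraMap K D) q := by
      simp only [e, AlgEquiv.trans_apply, renameEquiv_apply, h1]
      exact h2
    rw [h3]
    change map (algebraMap D L) _ = _
    rw [map_map]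
    rfl
  let J : Ideal E := Ideal.span {map (algebraMap K L) f, map (algebraMap K L) g}
  have hJ : J ≠ ⊤ := by
    have : J ≤ RingHom.ker (constantCoeff : E →+* L) := by
      rw [Ideal.span_le]
      rintro _ (rfl | rfl)
      · exact (constantCoeff_map _ _).trans (by rw [hf, map_zero])
      · exact (constantCoeff_map _ _).trans (by rw [hg, map_zero])
    exact ne_top_of_le_ne_top (RingHom.ker_ne_top _) this
  obtain ⟨Q, hQ⟩ := Ideal.nonempty_minimalPrimes hJ
  have := hQ.isPrime
  have hQ2 : Q.height ≤ 2 := by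
    refine (Ideal.height_le_card_of_mem_minimalPrimes_span (Set.toFinite _) hQ).trans ?_
    exact_mod_cast Set.ncard_insert_le _ _ |>.trans (by simp)
  refine ⟨(Q.under B).comap e.toRingEquiv, inferInstance, ?_, ?_, ?_⟩
  · change algebraMap B E (e _) ∈ Q
    rw [he]
    exact hQ.1.2 (Ideal.subset_span (by simp))
  · change algebraMap B E (e _) ∈ Q
    rw [he]
    exact hQ.1.2 (Ideal.subset_span (by simp))
  · rw [RingEquiv.height_comap,
      IsLocalization.height_under ((nonZeroDivisors D).map (MvPolynomial.C (σ := s)))]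
    exact hQ2

/-- A generic polynomial with two coprime monomials is prime. -/
theorem MvPolynomial.prime_sum_monomial_X {K σ : Type} [Field K] (S : Finset (σ →₀ ℕ))
    {i j : σ} (hij : i ≠ j) {d : ℕ} (hi : Finsupp.single i d ∈ S) (hj : Finsupp.single j d ∈ S) :
    Prime (∑ a ∈ S, monomial a (MvPolynomial.X a : MvPolynomial (σ →₀ ℕ) K)) := by
  classical
  rw [← MulEquiv.prime_iff (commAlgEquiv K σ (σ →₀ ℕ)), ← irreducible_iff_prime]
  let c : (σ →₀ ℕ) →₀ MvPolynomial σ K := ∑ a ∈ S, Finsupp.single a (monomial a 1)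
  have hc (a) (ha : a ∈ S) : c a = monomial a 1 := by
    simp [c, Finsupp.finsetSum_apply, Finsupp.single_apply, ha]
  have hsum : commAlgEquiv K σ (σ →₀ ℕ) (∑ a ∈ S, monomial a (MvPolynomial.X a)) =
      sumSMulX c := by
    rw [map_sum, map_sum]
    refine Finset.sum_congr rfl fun a _ => ?_
    rw [sumSMulX, Finsupp.linearCombination_single, ← mul_one (MvPolynomial.X a),
      ← C_mul_monomial, map_mul, commAlgEquiv_C, MvPolynomial.smul_eq_C_mul, mul_comm, map_X]
    congr 1
    rw [monomial_eq, map_mul, map_one, map_one, one_mul, Finsupp.prod, map_prod, monomial_eq,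
      map_one, one_mul, Finsupp.prod, map_prod]
    simp
  have hrel : IsRelPrime (monomial (Finsupp.single i d) (1 : K))
      (monomial (Finsupp.single j d) 1) := by
    rw [← X_pow_eq_monomial, ← X_pow_eq_monomial]
    refine IsRelPrime.pow ?_
    refine (MvPolynomial.X_prime (i := i)).irreducible.isRelPrime_iff_not_dvd.2 fun h => ?_
    rw [X_dvd_X] at h
    tauto
  change Irreducible (commAlgEquiv K σ (σ →₀ ℕ) _)
  rw [hsum]
  refine irreducible_sumSMulX c ⟨_, Finsupp.mem_support_iff.2 (?_ : c (.single i d) ≠ 0)⟩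
    fun r hr => hrel ?_ ?_
  · simp [hc _ hi]
  · exact hc _ hi ▸ hr _
  · exact hc _ hj ▸ hr _

/-- Two-generator regularity modulo a prime element `x`, tested through a retraction `ε` that
kills `x`. -/
theorem mem_span_pair_of_mul_mem {R : Type} [CommRing R] [IsDomain R] {x F G : R} (hx : Prime x)
    (ε : R →+* R) (hεx : ε x = 0) (hε : ∀ p, x ∣ p - ε p) (hF : Prime (ε F))
    (hFG : ¬ ε F ∣ ε G) (g : R) (hg : x * g ∈ Ideal.span {F, G}) : g ∈ Ideal.span {F, G} := by
  obtain ⟨a, b, hab⟩ := Ideal.mem_span_pair.1 hg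
  have h0 : ε a * ε F + ε b * ε G = 0 := by
    rw [← map_mul, ← map_mul, ← map_add, hab, map_mul, hεx, zero_mul]
  obtain ⟨h, hh⟩ : ε F ∣ ε b :=
    (hF.dvd_or_dvd (⟨-ε a, by linear_combination h0⟩ : ε F ∣ ε b * ε G)).resolve_right hFG
  obtain ⟨u, hu⟩ := hε b
  obtain ⟨v, hv⟩ := hε F
  have hdvd : x ∣ F * (a + h * G) :=
    ⟨g - u * G + v * h * G, by linear_combination hab - G * hu - G * hh + h * G * hv⟩
  obtain ⟨w, hw⟩ := (hx.dvd_or_dvd hdvd).resolve_left fun ⟨q, hq⟩ =>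
    hF.ne_zero (by rw [hq, map_mul, hεx, zero_mul])
  refine Ideal.mem_span_pair.2 ⟨w, u - v * h, mul_left_cancel₀ hx.ne_zero ?_⟩
  linear_combination hab - F * hw - G * hu - G * hh + h * G * hv

theorem two_le_height_of_prime_mem {R : Type} [CommRing R] [IsDomain R] {F G : R} (hF : Prime F)
    (hFG : ¬ F ∣ G) (P : PrimeSpectrum R) (hP : Ideal.span {F, G} ≤ P.asIdeal) :
    2 ≤ Order.height P := by
  let Q : PrimeSpectrum R := ⟨Ideal.span {F}, (Ideal.span_singleton_prime hF.ne_zero).2 hF⟩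
  let O : PrimeSpectrum R := ⟨⊥, Ideal.isPrime_bot⟩
  have hOQ : O < Q := by
    change (⊥ : Ideal R) < Ideal.span {F}
    rw [bot_lt_iff_ne_bot, Ne, Ideal.span_singleton_eq_bot]
    exact hF.ne_zero
  have hQP : Q < P := by
    change Ideal.span {F} < P.asIdeal
    refine lt_of_le_of_ne ((Ideal.span_mono (by simp)).trans hP) fun h => hFG ?_
    rw [← Ideal.mem_span_singleton, h]
    exact hP (Ideal.subset_span (by simp))
  calc (2 : ℕ∞) = 0 + 1 + 1 := by norm_num
    _ ≤ Order.height O + 1 + 1 := by gcongr; exact zero_le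
    _ ≤ Order.height Q + 1 := by gcongr; exact Order.height_add_one_le hOQ
    _ ≤ Order.height P := Order.height_add_one_le hQP

/-- Setting the variable `i` to zero. -/
noncomputable def killVar {σ A : Type} [DecidableEq σ] [CommRing A] (i : σ) :
    MvPolynomial σ A →ₐ[A] MvPolynomial σ A :=
  MvPolynomial.aeval fun j => if j = i then 0 else MvPolynomial.X j

theorem X_dvd_sub_killVar {σ A : Type} [DecidableEq σ] [CommRing A] (i : σ)
    (p : MvPolynomial σ A) : MvPolynomial.X i ∣ p - killVar i p := by
  induction p using MvPolynomial.induction_on with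
  | C a => simp [killVar]
  | add p q hp hq =>
    rw [map_add, add_sub_add_comm]
    exact dvd_add hp hq
  | mul_X p j hp =>
    rw [map_mul]
    by_cases h : j = i
    · subst h
      simp [killVar]
    · have : killVar i (MvPolynomial.X j : MvPolynomial σ A) = MvPolynomial.X j := by
        simp [killVar, h]
      rw [this, ← sub_mul]
      exact hp.mul_right _

theorem killVar_monomial {σ A : Type} [DecidableEq σ] [CommRing A] (i : σ) (a : σ →₀ ℕ) (r : A) :
    killVar i (monomial a r) = if a i = 0 then monomial a r else 0 := by
  rw [killVar, MvPolynomial.aeval_monomial, MvPolynomial.algebraMap_eq]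
  split_ifs with h
  · rw [MvPolynomial.monomial_eq]
    congr 1
    refine Finsupp.prod_congr fun j hj => ?_
    rw [if_neg]
    rintro rfl
    exact (Finsupp.mem_support_iff.1 hj) h
  · rw [Finsupp.prod, Finset.prod_eq_zero (Finsupp.mem_support_iff.2 h), mul_zero]
    rw [if_pos rfl, zero_pow h]

/-- Evaluation of the coefficients `c` and the variables `x`. -/
noncomputable def evalAt {K σ τ : Type} [Field K] (c : τ → K) (x : σ → K) :
    MvPolynomial σ (MvPolynomial τ K) →ₐ[K] K :=
  (MvPolynomial.aeval x).comp (MvPolynomial.mapAlgHom (MvPolynomial.aeval c))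

theorem evalAt_C {K σ τ : Type} [Field K] (c : τ → K) (x : σ → K) (p : MvPolynomial τ K) :
    evalAt c x (MvPolynomial.C p) = eval c p := by
  simp [evalAt, MvPolynomial.aeval_eq_eval]

theorem evalAt_X {K σ τ : Type} [Field K] (c : τ → K) (x : σ → K) (i : σ) :
    evalAt c x (MvPolynomial.X i) = x i := by
  simp [evalAt]

theorem evalAt_eq_sum {K σ τ : Type} [Field K] [Fintype σ] (c : τ → K) (x : σ → K)
    (p : MvPolynomial σ (MvPolynomial τ K)) :
    evalAt c x p = ∑ m ∈ p.support, eval c (coeff m p) * ∏ i, x i ^ m i := by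
  conv_lhs => rw [p.as_sum]
  rw [map_sum]
  refine Finset.sum_congr rfl fun m _ => ?_
  rw [monomial_eq, map_mul, evalAt_C, Finsupp.prod_fintype _ _ (fun _ => pow_zero _), map_prod]
  simp [evalAt_X]

theorem evalAt_killVar {K σ τ : Type} [DecidableEq σ] [Field K] (c : τ → K) (x : σ → K) (i : σ)
    (hi : x i = 0) (p : MvPolynomial σ (MvPolynomial τ K)) :
    evalAt c x (killVar i p) = evalAt c x p := by
  obtain ⟨q, hq⟩ := X_dvd_sub_killVar i p
  have := congrArg (evalAt c x) hq
  rw [map_sub, map_mul, evalAt_X, hi, zero_mul] at this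
  exact (sub_eq_zero.1 this).symm

/-- The restriction of `F_c` to the line through `x` with direction `z`. -/
noncomputable def linePoly {K : Type} [Field K] {n : ℕ} (d : ℕ) (c : (Fin (n + 1) →₀ ℕ) → K)
    (x z : Fin (n + 1) → K) : K[X] :=
  ∑ a ∈ Finset.finsuppAntidiag (Finset.univ : Finset (Fin (n + 1))) d,
    Polynomial.C (c a) *
      a.prod fun i e => (Polynomial.C (x i) + Polynomial.X * Polynomial.C (z i)) ^ e

theorem evalAt_genericPoly {K : Type} [Field K] {n : ℕ} (d : ℕ) (c : (Fin (n + 1) →₀ ℕ) → K)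
    (x : Fin (n + 1) → K) :
    evalAt c x (genericPoly K n d) =
      ∑ a ∈ Finset.finsuppAntidiag (Finset.univ : Finset (Fin (n + 1))) d,
        c a * a.prod fun i e => x i ^ e := by
  rw [genericPoly, map_sum]
  refine Finset.sum_congr rfl fun a _ => ?_
  rw [monomial_eq, map_mul, evalAt_C, Finsupp.prod, map_prod]
  simp [evalAt_X, Finsupp.prod]

theorem eval_map_dirCoeffY_genericPoly {K : Type} [Field K] {n : ℕ} (d k : ℕ)
    (c : (Fin (n + 1) →₀ ℕ) → K) (x z : Fin (n + 1) → K) :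
    eval z (map (evalAt c x : _ →+* K) (dirCoeffY (genericPoly K n d) k)) =
      k.factorial * (linePoly d c x z).coeff k := by
  let χ := (MvPolynomial.eval z).comp
    (map (evalAt c x : MvPolynomial (Fin (n + 1)) (MvPolynomial (Fin (n + 1) →₀ ℕ) K) →+* K))
  change χ _ = _
  rw [dirCoeffY, map_mul, map_natCast, ← Polynomial.coeff_map, genericPoly, map_sum,
    Polynomial.map_sum, linePoly]
  refine congrArg (_ * Polynomial.coeff · k) (Finset.sum_congr rfl fun a _ => ?_)
  rw [MvPolynomial.aeval_monomial, Polynomial.map_mul, Finsupp.prod, Polynomial.map_prod]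
  congr 2
  · change Polynomial.map χ (Polynomial.C (MvPolynomial.C (MvPolynomial.C _))) = _
    simp [χ, evalAt_C]
  · simp [χ, evalAt_X]

theorem isHomogeneous_dirCoeffY {R : Type} [CommRing R] {n : ℕ}
    (f : MvPolynomial (Fin (n + 1)) R) (k : ℕ) : (dirCoeffY f k).IsHomogeneous k := by
  have key : ∀ k, (Polynomial.coeff (MvPolynomial.aeval
        (fun i : Fin (n + 1) => Polynomial.C (MvPolynomial.C (MvPolynomial.X i)) +
          Polynomial.X * Polynomial.C (MvPolynomial.X i)) f) k :
        MvPolynomial (Fin (n + 1)) (MvPolynomial (Fin (n + 1)) R)).IsHomogeneous k := by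
    induction f using MvPolynomial.induction_on with
    | C a =>
      intro k
      rw [MvPolynomial.aeval_C]
      change (Polynomial.coeff (Polynomial.C (MvPolynomial.C (MvPolynomial.C a))) k).IsHomogeneous k
      rw [Polynomial.coeff_C]
      split_ifs with h
      · exact h ▸ isHomogeneous_C _ _
      · exact isHomogeneous_zero _ _ _
    | add p q hp hq =>
      intro k
      rw [map_add, Polynomial.coeff_add]
      exact (hp k).add (hq k)
    | mul_X p i hp =>
      intro k
      rw [map_mul, MvPolynomial.aeval_X, mul_add, ← mul_assoc, Polynomial.coeff_add,
        Polynomial.coeff_mul_C, Polynomial.coeff_mul_C]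
      refine .add (by simpa using (hp k).mul (isHomogeneous_C _ _)) ?_
      cases k with
      | zero => simpa using isHomogeneous_zero _ _ _
      | succ k =>
        rw [Polynomial.coeff_mul_X]
        exact (hp k).mul (isHomogeneous_X _ _)
  rw [dirCoeffY, ← map_natCast MvPolynomial.C]
  have := (isHomogeneous_C (Fin (n + 1)) (k.factorial : MvPolynomial (Fin (n + 1)) R)).mul (key k)
  rwa [zero_add] at this

/-- At a nonzero point of `F_c`, the polynomial `Φ` detects lines of contact order above `n`. -/
theorem evalAt_flex_eq_zero_iff {K : Type} [Field K] [CharZero K] {n d : ℕ}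
    (Res : ∀ (R : Type) [CommRing R] [Algebra K R],
      (Fin (n + 1) → MvPolynomial (Fin (n + 1)) R) → R)
    (hnat : ∀ (R : Type) [CommRing R] [Algebra K R] (S : Type) [CommRing S] [Algebra K S]
      (φ : R →ₐ[K] S) (sys : Fin (n + 1) → MvPolynomial (Fin (n + 1)) R),
      Res S (fun i => MvPolynomial.map (φ : R →+* S) (sys i)) = φ (Res R sys))
    (hvan : ∀ sys : Fin (n + 1) → MvPolynomial (Fin (n + 1)) K,
      (∀ i, (sys i).IsHomogeneous (Fin.lastCases 1 (fun j : Fin n => (j : ℕ) + 1) i)) →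
      (Res K sys = 0 ↔ ∃ z : Fin (n + 1) → K, z ≠ 0 ∧ ∀ i, MvPolynomial.eval z (sys i) = 0))
    (Φ : MvPolynomial (Fin (n + 1)) (MvPolynomial (Fin (n + 1) →₀ ℕ) K))
    (hcong : ∀ ℓ : MvPolynomial (Fin (n + 1)) K, ℓ.IsHomogeneous 1 →
      genericPoly K n d ∣
        (Res (MvPolynomial (Fin (n + 1)) (MvPolynomial (Fin (n + 1) →₀ ℕ) K))
            (Fin.lastCases
              (MvPolynomial.map
                (algebraMap K (MvPolynomial (Fin (n + 1)) (MvPolynomial (Fin (n + 1) →₀ ℕ) K))) ℓ)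
              (fun j : Fin n => dirCoeffY (genericPoly K n d) ((j : ℕ) + 1))) -
          (MvPolynomial.map
            (algebraMap K (MvPolynomial (Fin (n + 1) →₀ ℕ) K)) ℓ) ^ n.factorial * Φ))
    (c : (Fin (n + 1) →₀ ℕ) → K) (x : Fin (n + 1) → K)
    (hF : evalAt c x (genericPoly K n d) = 0) (i : Fin (n + 1)) (hi : x i ≠ 0) :
    evalAt c x Φ = 0 ↔ ∃ z : Fin (n + 1) → K, z ≠ 0 ∧ z i = 0 ∧
      ∀ j : Fin n, (linePoly d c x z).coeff (j + 1) = 0 := by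
  obtain ⟨q, hq⟩ := hcong (MvPolynomial.X i) (isHomogeneous_X _ _)
  have h := congrArg (evalAt c x) hq
  rw [map_mul, hF, zero_mul, map_sub, sub_eq_zero, ← hnat, map_mul, map_pow, MvPolynomial.map_X,
    MvPolynomial.map_X, evalAt_X] at h
  rw [← mul_eq_zero_iff_left (pow_ne_zero _ hi), ← h, hvan]
  · refine exists_congr fun z => and_congr_right fun _ => ?_
    rw [Fin.forall_fin_succ', and_comm]
    simp only [Fin.lastCases_last, Fin.lastCases_castSucc, eval_map_dirCoeffY_genericPoly,
      MvPolynomial.map_X, MvPolynomial.eval_X, mul_eq_zero, Nat.cast_eq_zero,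
      Nat.factorial_ne_zero, false_or]
  · intro k
    induction k using Fin.lastCases with
    | last => simpa using isHomogeneous_X _ _
    | cast j =>
      simp only [Fin.lastCases_castSucc]
      exact (isHomogeneous_dirCoeffY _ _).map _

theorem sum_finsuppAntidiag_sum_single {K M σ ι : Type} [Field K] [CommRing M] [Fintype σ]
    [DecidableEq σ] [Fintype ι] (f : K →+* M) (d : ℕ) (m : ι → σ →₀ ℕ)
    (hm : ∀ k, m k ∈ Finset.finsuppAntidiag Finset.univ d) (w : ι → K) (T : (σ →₀ ℕ) → M) :
    ∑ a ∈ Finset.finsuppAntidiag Finset.univ d,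
      f ((∑ k, Pi.single (m k) (w k) : (σ →₀ ℕ) → K) a) * T a = ∑ k, f (w k) * T (m k) := by
  simp only [Finset.sum_apply, map_sum, Finset.sum_mul]
  rw [Finset.sum_comm]
  refine Finset.sum_congr rfl fun k _ => ?_
  rw [Finset.sum_eq_single_of_mem (m k) (hm k)]
  · simp
  · intro b _ hb
    simp [Pi.single_eq_of_ne hb]

theorem linePoly_sum_single {K ι : Type} [Field K] {n : ℕ} [Fintype ι] (d : ℕ)
    (m : ι → Fin (n + 1) →₀ ℕ) (hm : ∀ k, m k ∈ Finset.finsuppAntidiag Finset.univ d)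
    (w : ι → K) (x z : Fin (n + 1) → K) :
    linePoly d (∑ k, Pi.single (m k) (w k)) x z = ∑ k, Polynomial.C (w k) *
      (m k).prod fun i e => (Polynomial.C (x i) + Polynomial.X * Polynomial.C (z i)) ^ e :=
  sum_finsuppAntidiag_sum_single Polynomial.C d m hm w _

theorem evalAt_genericPoly_sum_single {K ι : Type} [Field K] {n : ℕ} [Fintype ι] (d : ℕ)
    (m : ι → Fin (n + 1) →₀ ℕ) (hm : ∀ k, m k ∈ Finset.finsuppAntidiag Finset.univ d)
    (w : ι → K) (x : Fin (n + 1) → K) :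
    evalAt (∑ k, Pi.single (m k) (w k)) x (genericPoly K n d) =
      ∑ k, w k * (m k).prod fun i e => x i ^ e := by
  rw [evalAt_genericPoly]
  exact sum_finsuppAntidiag_sum_single (RingHom.id K) d m hm w _

theorem evalAt_sum_single {K σ τ ι : Type} [Field K] [Fintype σ] [Fintype ι] [DecidableEq τ]
    (m : ι → τ) (w : ι → K) (x : σ → K) (p : MvPolynomial σ (MvPolynomial τ K))
    (hp : ∀ a, (coeff a p).IsHomogeneous 1) :
    evalAt (∑ k, Pi.single (m k) (w k)) x p = ∑ k, w k * evalAt (Pi.single (m k) 1) x p := by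
  have hlin (q : MvPolynomial τ K) (hq : q.IsHomogeneous 1) :
      eval (∑ k, Pi.single (m k) (w k)) q = ∑ k, w k * eval (Pi.single (m k) 1) q := by
    rw [← mem_homogeneousSubmodule, homogeneousSubmodule_one_eq_span_X] at hq
    induction hq using Submodule.span_induction with
    | mem _ h =>
      obtain ⟨i, rfl⟩ := h
      simp [Finset.sum_apply, Pi.single_apply]
    | zero => simp
    | add _ _ _ _ h1 h2 => simp only [map_add, h1, h2, mul_add, Finset.sum_add_distrib]
    | smul r _ _ h =>
      simp only [MvPolynomial.smul_eq_C_mul, map_mul, MvPolynomial.eval_C, h, Finset.mul_sum,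
        mul_left_comm]
  simp only [evalAt_eq_sum, hlin _ (hp _), Finset.sum_mul, Finset.mul_sum, mul_assoc]
  exact Finset.sum_comm

/-- The exponents of the hypersurface `∑ k, x_k ^ (k + 1) * x_n ^ (d - k - 1)`. -/
noncomputable def nonflexExponent (n d : ℕ) (k : Fin n) : Fin (n + 1) →₀ ℕ :=
  Finsupp.single k.castSucc ((k : ℕ) + 1) + Finsupp.single (Fin.last n) (d - (k + 1))

theorem nonflexExponent_mem {n d : ℕ} (hd : n ≤ d) (k : Fin n) :
    nonflexExponent n d k ∈ Finset.finsuppAntidiag Finset.univ d := by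
  rw [Finset.mem_finsuppAntidiag]
  refine ⟨?_, Finset.subset_univ _⟩
  change ∑ i, (Finsupp.single k.castSucc ((k : ℕ) + 1) +
    Finsupp.single (Fin.last n) (d - (k + 1))) i = d
  simp only [Finsupp.add_apply, Finset.sum_add_distrib, Finsupp.single_apply,
    Finset.sum_ite_eq, Finset.mem_univ, if_true]
  omega

theorem prod_single_pow {σ M : Type} [CommRing M] (i : σ) (e : ℕ) (g : σ → M) :
    (Finsupp.single i e).prod (fun i e => g i ^ e) = g i ^ e :=
  Finsupp.prod_single_index (pow_zero _)

theorem prod_nonflexExponent {M : Type} [CommRing M] {n d : ℕ} (k : Fin n) (g : Fin (n + 1) → M) :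
    (nonflexExponent n d k).prod (fun i e => g i ^ e) =
      g k.castSucc ^ ((k : ℕ) + 1) * g (Fin.last n) ^ (d - (k + 1)) := by
  rw [nonflexExponent, Finsupp.prod_add_index' (fun _ => pow_zero _) (fun _ _ _ => pow_add _ _ _),
    prod_single_pow, prod_single_pow]

theorem evalAt_nonflex_genericPoly {K : Type} [Field K] {n d : ℕ} (hd : n ≤ d) :
    evalAt (∑ k, Pi.single (nonflexExponent n d k) 1) (Pi.single (Fin.last n) (1 : K))
      (genericPoly K n d) = 0 := by
  rw [evalAt_genericPoly_sum_single d _ (nonflexExponent_mem hd) (fun _ => 1)]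
  refine Finset.sum_eq_zero fun k _ => ?_
  rw [prod_nonflexExponent, Pi.single_eq_of_ne (Fin.castSucc_lt_last k).ne]
  simp

theorem not_contact_nonflex {K : Type} [Field K] {n d : ℕ} (hd : n ≤ d) :
    ¬ ∃ z : Fin (n + 1) → K, z ≠ 0 ∧ z (Fin.last n) = 0 ∧ ∀ j : Fin n,
      (linePoly d (∑ k, Pi.single (nonflexExponent n d k) 1) (Pi.single (Fin.last n) (1 : K))
        z).coeff (j + 1) = 0 := by
  rintro ⟨z, hz, hlast, hcoeff⟩
  refine hz (funext fun i => ?_)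
  induction i using Fin.lastCases with
  | last => exact hlast
  | cast j =>
    have h := hcoeff j
    rw [linePoly_sum_single d _ (nonflexExponent_mem hd) (fun _ => 1), Polynomial.finsetSum_coeff,
      Finset.sum_eq_single j] at h
    · rw [prod_nonflexExponent, Pi.single_eq_of_ne (Fin.castSucc_lt_last j).ne, hlast] at h
      simp only [Pi.single_eq_same, Polynomial.C_0, Polynomial.C_1, zero_add, mul_zero, add_zero,
        one_pow, mul_one, one_mul, mul_pow, ← Polynomial.C_pow, Polynomial.coeff_mul_C,
        Polynomial.coeff_X_pow_self] at h
      exact eq_zero_of_pow_eq_zero h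
    · intro k _ hk
      rw [prod_nonflexExponent, Pi.single_eq_of_ne (Fin.castSucc_lt_last k).ne, hlast]
      have : (k : ℕ) ≠ j := fun h => hk (Fin.ext h)
      simp only [Pi.single_eq_same, Polynomial.C_0, Polynomial.C_1, zero_add, mul_zero, add_zero,
        one_pow, mul_one, one_mul, mul_pow, ← Polynomial.C_pow, Polynomial.coeff_mul_C,
        Polynomial.coeff_X_pow]
      rw [if_neg (by omega), zero_mul]
    · simp

/-- The three monomials of degree `d` used for binary forms with a double root. -/
noncomputable def binaryExponent (d : ℕ) : Fin 3 → Fin 2 →₀ ℕ :=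
  ![Finsupp.single 0 d, nonflexExponent 1 d 0, Finsupp.single 1 d]

theorem binaryExponent_mem {d : ℕ} (hd : 1 ≤ d) (k : Fin 3) :
    binaryExponent d k ∈ Finset.finsuppAntidiag Finset.univ d := by
  fin_cases k
  · simp [binaryExponent, Finset.mem_finsuppAntidiag]
  · exact nonflexExponent_mem hd 0
  · simp [binaryExponent, Finset.mem_finsuppAntidiag]

theorem sum_prod_binaryExponent {M : Type} [CommRing M] (d : ℕ) (w : Fin 3 → M) (g : Fin 2 → M) :
    ∑ k, w k * (binaryExponent d k).prod (fun i e => g i ^ e) =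
      w 0 * g 0 ^ d + w 1 * (g 0 * g 1 ^ (d - 1)) + w 2 * g 1 ^ d := by
  have := prod_nonflexExponent (n := 1) (d := d) 0 g
  simp only [Fin.sum_univ_three, binaryExponent, Matrix.cons_val, this, prod_single_pow]
  simp

theorem coeff_linePoly_doubleRoot {K : Type} [Field K] (d : ℕ) (s : K) :
    (Polynomial.C (1 : K) * (Polynomial.C s + Polynomial.X * Polynomial.C 1) ^ d +
      Polynomial.C (-(d * s ^ (d - 1))) * ((Polynomial.C s + Polynomial.X * Polynomial.C 1) *
        (Polynomial.C 1 + Polynomial.X * Polynomial.C 0) ^ (d - 1)) +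
      Polynomial.C ((d - 1) * s ^ d) * (Polynomial.C 1 + Polynomial.X * Polynomial.C 0) ^ d).coeff 1
      = 0 := by
  simp only [Polynomial.C_0, Polynomial.C_1, mul_zero, add_zero, one_pow, mul_one, one_mul,
    Polynomial.coeff_add, Polynomial.coeff_C_mul, add_comm (Polynomial.C s),
    Polynomial.coeff_X_add_C_pow, Polynomial.coeff_C, if_neg one_ne_zero]
  simp [mul_comm]

/-- The values of `Φ` at `(c, (s, 1))`, as a polynomial in `s`. -/
noncomputable def slicePoly {K τ : Type} [Field K] (c : τ → K)
    (p : MvPolynomial (Fin 2) (MvPolynomial τ K)) : K[X] :=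
  ∑ m ∈ p.support, Polynomial.C (eval c (coeff m p)) * Polynomial.X ^ m 0

theorem eval_slicePoly {K τ : Type} [Field K] (c : τ → K)
    (p : MvPolynomial (Fin 2) (MvPolynomial τ K)) (s : K) :
    (slicePoly c p).eval s = evalAt c ![s, 1] p := by
  simp [slicePoly, evalAt_eq_sum, Polynomial.eval_finsetSum]

theorem coeff_slicePoly {K τ : Type} [Field K] (c : τ → K)
    {p : MvPolynomial (Fin 2) (MvPolynomial τ K)} {N k : ℕ} (hp : p.IsHomogeneous N) (hk : N < k) :
    (slicePoly c p).coeff k = 0 := by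
  rw [slicePoly, Polynomial.finsetSum_coeff]
  refine Finset.sum_eq_zero fun m hm => ?_
  rw [Polynomial.coeff_C_mul_X_pow, if_neg]
  have := hp (mem_support_iff.1 hm)
  rw [Finsupp.weight_apply, Finsupp.sum_fintype _ _ (by simp), Fin.sum_univ_two] at this
  simp at this
  omega

/-- No polynomial of bidegree `(1, d - 2)` detects the double roots of binary forms. -/
theorem false_of_binary {K : Type} [Field K] [CharZero K] {d : ℕ} (hd : 1 ≤ d)
    (Φ : MvPolynomial (Fin 2) (MvPolynomial (Fin 2 →₀ ℕ) K))
    (hΦx : Φ.IsHomogeneous (d - 2)) (hΦc : ∀ m, (coeff m Φ).IsHomogeneous 1)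
    (hflex : ∀ (c : (Fin 2 →₀ ℕ) → K) (x : Fin 2 → K), evalAt c x (genericPoly K 1 d) = 0 →
      ∀ i, x i ≠ 0 → (evalAt c x Φ = 0 ↔ ∃ z : Fin 2 → K, z ≠ 0 ∧ z i = 0 ∧
        ∀ j : Fin 1, (linePoly d c x z).coeff (j + 1) = 0)) : False := by
  have hne : evalAt (Pi.single (nonflexExponent 1 d 0) 1) ![0, 1] Φ ≠ 0 := by
    have h := hflex _ _ (evalAt_nonflex_genericPoly hd) 1 (by simp)
    have h2 := h.not.2 (not_contact_nonflex hd)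
    have hx : (Pi.single (Fin.last 1) (1 : K) : Fin 2 → K) = ![0, 1] := by
      ext i; fin_cases i <;> simp
    rwa [hx, Fin.sum_univ_one] at h2
  obtain rfl | hd2 := hd.eq_or_lt
  · have hconst (c : (Fin 2 →₀ ℕ) → K) (x y : Fin 2 → K) : evalAt c x Φ = evalAt c y Φ := by
      rw [totalDegree_eq_zero_iff_eq_C.1 ((totalDegree_zero_iff_isHomogeneous _).2 hΦx),
        evalAt_C, evalAt_C]
    set a := evalAt (Pi.single (nonflexExponent 1 1 0) 1) ![0, 1] Φ with ha
    set b := evalAt (Pi.single (Finsupp.single 1 1) 1) ![0, 1] Φ with hb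
    have hzero : evalAt (∑ k, Pi.single (binaryExponent 1 k) ((![0, b, -a] : Fin 3 → K) k))
        ![a, b] Φ = 0 := by
      rw [hconst _ _ ![0, 1], evalAt_sum_single _ _ _ _ hΦc, Fin.sum_univ_three]
      simp only [binaryExponent, Matrix.cons_val, ← ha, ← hb]
      ring
    obtain ⟨z, hz, hz0, hcoeff⟩ := (hflex _ _ (by
      rw [evalAt_genericPoly_sum_single 1 _ (binaryExponent_mem hd), sum_prod_binaryExponent]
      simp
      ring) 0 (by simpa using hne)).1 hzero
    have h := hcoeff 0
    rw [linePoly_sum_single 1 _ (binaryExponent_mem hd),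
      sum_prod_binaryExponent 1 (fun k => Polynomial.C (_ : K)), hz0] at h
    have hz1 : z 1 = 0 := by
      simpa [hne] using h
    refine hz (funext fun i => ?_)
    fin_cases i
    · exact hz0
    · exact hz1
  · have hroot (s : K) : evalAt (∑ k, Pi.single (binaryExponent d k)
        ((![1, -(d * s ^ (d - 1)), (d - 1) * s ^ d] : Fin 3 → K) k)) ![s, 1] Φ = 0 := by
      refine (hflex _ _ ?_ 1 (by simp)).2 ⟨![1, 0], by simp, by simp, fun j => ?_⟩
      · rw [evalAt_genericPoly_sum_single d _ (binaryExponent_mem hd), sum_prod_binaryExponent]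
        obtain ⟨e, rfl⟩ : ∃ e, d = e + 1 := ⟨d - 1, by omega⟩
        simp
        ring
      · rw [linePoly_sum_single d _ (binaryExponent_mem hd),
          sum_prod_binaryExponent d (fun k => Polynomial.C (_ : K)), Subsingleton.elim j 0]
        exact coeff_linePoly_doubleRoot d s
    let P (k : Fin 3) := slicePoly (Pi.single (binaryExponent d k) 1) Φ
    have hP : P 0 - Polynomial.C (d : K) * Polynomial.X ^ (d - 1) * P 1 +
        Polynomial.C (d - 1 : K) * Polynomial.X ^ d * P 2 = 0 := by
      refine Polynomial.funext fun s => ?_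
      have h := hroot s
      rw [evalAt_sum_single _ _ _ _ hΦc, Fin.sum_univ_three] at h
      simp only [← eval_slicePoly] at h
      simp only [Matrix.cons_val] at h
      simp only [P, Polynomial.eval_add, Polynomial.eval_sub, Polynomial.eval_mul,
        Polynomial.eval_C, Polynomial.eval_pow, Polynomial.eval_X, Polynomial.eval_zero]
      linear_combination h
    have hcoeff := congrArg (Polynomial.coeff · (d - 1)) hP
    simp only [Polynomial.coeff_add, Polynomial.coeff_sub, mul_assoc, Polynomial.coeff_C_mul,
      Polynomial.coeff_X_pow_mul', Polynomial.coeff_zero] at hcoeff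
    rw [coeff_slicePoly _ hΦx (by omega), if_neg (by omega : ¬ d ≤ d - 1)] at hcoeff
    have hd0 : (d : K) ≠ 0 := Nat.cast_ne_zero.2 (by omega)
    apply hne
    rw [← eval_slicePoly, ← Polynomial.coeff_zero_eq_eval_zero]
    simpa [hd0, P, binaryExponent] using hcoeff

theorem prime_genericPoly {K : Type} [Field K] {n : ℕ} (hn : 1 ≤ n) (d : ℕ) :
    Prime (genericPoly K n d) := by
  refine prime_sum_monomial_X _ (i := 0) (j := Fin.last n) (d := d) ?_ ?_ ?_
  · exact Fin.ne_of_val_ne (by simp; omega)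
  all_goals simp [Finset.mem_finsuppAntidiag]

theorem prime_killVar_genericPoly {K : Type} [Field K] {n : ℕ} (hn : 2 ≤ n) (d : ℕ) :
    Prime (killVar 0 (genericPoly K n d)) := by
  simp only [genericPoly, map_sum, killVar_monomial]
  rw [← Finset.sum_filter]
  refine prime_sum_monomial_X _ (i := ⟨1, by omega⟩) (j := ⟨2, by omega⟩) (d := d) (by simp) ?_ ?_
  all_goals
    exact Finset.mem_filter.2 ⟨by simp [Finset.mem_finsuppAntidiag],
      by simp [Fin.ext_iff]⟩

theorem constantCoeff_sumAlgEquiv_symm {K σ τ : Type} [Field K]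
    (p : MvPolynomial σ (MvPolynomial τ K)) :
    MvPolynomial.constantCoeff ((sumAlgEquiv K σ τ).symm p) = MvPolynomial.constantCoeff (MvPolynomial.constantCoeff p) := by
  have h : MvPolynomial.constantCoeff.comp
      ((sumAlgEquiv K σ τ).symm : MvPolynomial σ (MvPolynomial τ K) →+* MvPolynomial (σ ⊕ τ) K) =
      MvPolynomial.constantCoeff.comp MvPolynomial.constantCoeff := by
    ext <;> simp
  exact DFunLike.congr_fun h p

theorem universal_flex_ideal_height_two
    (K : Type) [Field K] [IsAlgClosed K] [CharZero K] (n d : ℕ) (hn : 1 ≤ n)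
    (hd : n ≤ d)
    -- the abstract resultant for degrees (1, 2, …, n, 1) in y₀,…,yₙ:
    (Res : ∀ (R : Type) [CommRing R] [Algebra K R],
      (Fin (n + 1) → MvPolynomial (Fin (n + 1)) R) → R)
    (hnat : ∀ (R : Type) [CommRing R] [Algebra K R] (S : Type) [CommRing S] [Algebra K S]
      (φ : R →ₐ[K] S) (sys : Fin (n + 1) → MvPolynomial (Fin (n + 1)) R),
      Res S (fun i => MvPolynomial.map (φ : R →+* S) (sys i)) = φ (Res R sys))
    (hvan : ∀ sys : Fin (n + 1) → MvPolynomial (Fin (n + 1)) K,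
      (∀ i, (sys i).IsHomogeneous (Fin.lastCases 1 (fun j : Fin n => (j : ℕ) + 1) i)) →
      (Res K sys = 0 ↔ ∃ z : Fin (n + 1) → K, z ≠ 0 ∧ ∀ i, MvPolynomial.eval z (sys i) = 0))
    -- the universal flex polynomial Φ_d:
    (Φ : MvPolynomial (Fin (n + 1)) (MvPolynomial (Fin (n + 1) →₀ ℕ) K))
    (hΦx : Φ.IsHomogeneous (d * (∑ k ∈ Finset.Icc 1 n, n.factorial / k) - (n + 1).factorial))
    (hΦc : ∀ m : Fin (n + 1) →₀ ℕ,
      (MvPolynomial.coeff m Φ).IsHomogeneous (∑ k ∈ Finset.Icc 1 n, n.factorial / k))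
    (hcong : ∀ ℓ : MvPolynomial (Fin (n + 1)) K, ℓ.IsHomogeneous 1 →
      genericPoly K n d ∣
        (Res (MvPolynomial (Fin (n + 1)) (MvPolynomial (Fin (n + 1) →₀ ℕ) K))
            (Fin.lastCases
              (MvPolynomial.map
                (algebraMap K (MvPolynomial (Fin (n + 1)) (MvPolynomial (Fin (n + 1) →₀ ℕ) K))) ℓ)
              (fun j : Fin n => dirCoeffY (genericPoly K n d) ((j : ℕ) + 1))) -
          (MvPolynomial.map
            (algebraMap K (MvPolynomial (Fin (n + 1) →₀ ℕ) K)) ℓ) ^ n.factorial * Φ)) :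
    (⨅ P : {P : PrimeSpectrum (MvPolynomial (Fin (n + 1)) (MvPolynomial (Fin (n + 1) →₀ ℕ) K)) //
        Ideal.span {genericPoly K n d, Φ} ≤ P.asIdeal},
      Order.height (P : PrimeSpectrum (MvPolynomial (Fin (n + 1)) (MvPolynomial (Fin (n + 1) →₀ ℕ) K)))) = 2 ∧
    (∀ g : MvPolynomial (Fin (n + 1)) (MvPolynomial (Fin (n + 1) →₀ ℕ) K),
      MvPolynomial.X 0 * g ∈ Ideal.span {genericPoly K n d, Φ} →
        g ∈ Ideal.span {genericPoly K n d, Φ}) := by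
  have hflex := evalAt_flex_eq_zero_iff Res hnat hvan Φ hcong
  obtain ⟨c, x, hx0, hF0, hΦ0⟩ : ∃ (c : (Fin (n + 1) →₀ ℕ) → K) (x : Fin (n + 1) → K),
      x 0 = 0 ∧ evalAt c x (genericPoly K n d) = 0 ∧ evalAt c x Φ ≠ 0 := by
    refine ⟨∑ k, Pi.single (nonflexExponent n d k) 1, Pi.single (Fin.last n) 1, ?_,
      evalAt_nonflex_genericPoly hd, ?_⟩
    · exact Pi.single_eq_of_ne (Fin.ne_of_val_ne (by simp; omega)) _
    · rw [Ne, hflex _ _ (evalAt_nonflex_genericPoly hd) (Fin.last n) (by simp)]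
      exact not_contact_nonflex hd
  have hndvd : ¬ genericPoly K n d ∣ Φ := fun h =>
    hΦ0 (zero_dvd_iff.1 (hF0 ▸ map_dvd (evalAt c x) h))
  have hF := prime_genericPoly (K := K) hn d
  have hD : ∑ k ∈ Finset.Icc 1 n, n.factorial / k ≠ 0 := by
    refine (Finset.sum_pos' (fun _ _ => zero_le) ⟨1, by simp [hn], ?_⟩).ne'
    simpa using n.factorial_pos
  refine ⟨le_antisymm ?_ (le_iInf fun P => two_le_height_of_prime_mem hF hndvd _ P.2), ?_⟩
  · obtain ⟨P, hP, hFP, hΦP, hP2⟩ := exists_isPrime_height_le_two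
      ((sumAlgEquiv K _ _).symm (genericPoly K n d)) ((sumAlgEquiv K _ _).symm Φ)
      (by
        rw [constantCoeff_sumAlgEquiv_symm, genericPoly, map_sum, map_sum]
        refine Finset.sum_eq_zero fun a _ => ?_
        rw [constantCoeff_monomial]
        split_ifs <;> simp)
      (by
        rw [constantCoeff_sumAlgEquiv_symm]
        exact (hΦc 0).coeff_eq_zero (by simpa using hD.symm))
    let e := (sumAlgEquiv K (Fin (n + 1)) (Fin (n + 1) →₀ ℕ)).symm.toRingEquiv
    refine (iInf_le _ ⟨⟨P.comap e, inferInstance⟩, ?_⟩).trans ?_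
    · rwa [← PrimeSpectrum.height_eq_orderHeight, RingEquiv.height_comap]
    · rw [Ideal.span_le]
      rintro _ (rfl | rfl)
      · exact hFP
      · exact hΦP
  · obtain rfl | hn2 := hn.eq_or_lt
    · exact (false_of_binary hd Φ (by simpa using hΦx) (by simpa using hΦc) hflex).elim
    · refine fun g => mem_span_pair_of_mul_mem X_prime (killVar 0).toRingHom (by simp [killVar])
        (X_dvd_sub_killVar 0) (prime_killVar_genericPoly hn2 d) (fun h => hΦ0 ?_) g
      have h2 := map_dvd (evalAt c x) h
      change evalAt c x (killVar 0 _) ∣ evalAt c x (killVar 0 _) at h2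
      rw [evalAt_killVar _ _ _ hx0, evalAt_killVar _ _ _ hx0, hF0] at h2
      exact zero_dvd_iff.1 h2
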